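/- There is no 6×6 complex matrix W that is symmetric (Wᵀ = W) and unitary (WW* = I) and satisfies both (i) Σ_{i,j=0}^{5} W_{ij} v_i(z) v_j(z) = 0 for all z ∈ ℂ, where v(z) = (1, √5·z, √10·z², √10·z³, √5·z⁴, z⁵), and (ii) W₃₄ = 0, W₄₄ = 0 and W₃₃ + √2·W₂₄ = 0. -/

import Mathlib

open Matrix Complex

/-- The degree-5 Veronese curve representative in `ℂ⁶`. -/
noncomputable def veronese5 (z : ℂ) : Fin 6 → ℂ :=
  ![1, (Real.sqrt 5 : ℂ) * z, (Real.sqrt 10 : ℂ) * z ^ 2,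
    (Real.sqrt 10 : ℂ) * z ^ 3, (Real.sqrt 5 : ℂ) * z ^ 4, z ^ 5]

/-- A complex polynomial function that vanishes everywhere has zero coefficients. -/
theorem coeff_eq_zero_of_forall_sum_eq_zero {n : ℕ} (a : Fin n → ℂ)
    (h : ∀ z : ℂ, ∑ k, a k * z ^ (k : ℕ) = 0) (k : Fin n) : a k = 0 := by
  have hp : (∑ i, Polynomial.C (a i) * Polynomial.X ^ (i : ℕ) : Polynomial ℂ) = 0 := by
    refine Polynomial.funext fun z => ?_
    simpa [Polynomial.eval_finsetSum] using h z
  have hk := congrArg (fun p => Polynomial.coeff p (k : ℕ)) hp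
  simpa [Polynomial.finsetSum_coeff, Polynomial.coeff_X_pow, Fin.val_inj] using hk

theorem stmt_0 :
    ¬ ∃ W : Matrix (Fin 6) (Fin 6) ℂ,
        Wᵀ = W ∧ W * Wᴴ = 1 ∧
        (∀ z : ℂ, ∑ i : Fin 6, ∑ j : Fin 6, W i j * veronese5 z i * veronese5 z j = 0) ∧
        W 3 4 = 0 ∧ W 4 4 = 0 ∧ W 3 3 + (Real.sqrt 2 : ℂ) * W 2 4 = 0 := by
  rintro ⟨W, hT, hU, hQ, h34, h44, h33⟩
  have hsymm (i j : Fin 6) : W j i = W i j := congrFun (congrFun hT i) j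
  have hy : (Real.sqrt 2 : ℂ) ^ 2 = 2 := by
    rw [← Complex.ofReal_pow, Real.sq_sqrt (by norm_num)]; norm_num
  have hx : (Real.sqrt 5 : ℂ) ^ 2 = 5 := by
    rw [← Complex.ofReal_pow, Real.sq_sqrt (by norm_num)]; norm_num
  have hxy : (Real.sqrt 10 : ℂ) = Real.sqrt 5 * Real.sqrt 2 := by
    rw [← Complex.ofReal_mul, ← Real.sqrt_mul (by norm_num)]; norm_num
  simp only [veronese5, hxy] at hQ
  generalize (Real.sqrt 2 : ℂ) = y at *
  generalize (Real.sqrt 5 : ℂ) = x at *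
  have hx0 : x ≠ 0 := by rintro rfl; norm_num at hx
  have hy0 : y ≠ 0 := by rintro rfl; norm_num at hy
  have hcoeff := coeff_eq_zero_of_forall_sum_eq_zero
    ![W 0 0, 2 * x * W 0 1, 2 * x * y * W 0 2 + 5 * W 1 1,
      2 * x * y * W 0 3 + 10 * y * W 1 2,
      2 * x * W 0 4 + 10 * y * W 1 3 + 10 * W 2 2,
      2 * W 0 5 + 10 * W 1 4 + 20 * W 2 3,
      2 * x * W 1 5 + 10 * y * W 2 4 + 10 * W 3 3,
      2 * x * y * W 2 5 + 10 * y * W 3 4,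
      2 * x * y * W 3 5 + 5 * W 4 4, 2 * x * W 4 5, W 5 5] (by
    intro z
    have h := hQ z
    simp [Fin.sum_univ_succ] at h ⊢
    simp [hsymm 0 1, hsymm 0 2, hsymm 0 3, hsymm 0 4, hsymm 0 5, hsymm 1 2, hsymm 1 3,
      hsymm 1 4, hsymm 1 5, hsymm 2 3, hsymm 2 4, hsymm 2 5, hsymm 3 4, hsymm 3 5, hsymm 4 5] at h
    linear_combination h
      - (W 1 1 * z ^ 2 + 2 * y * W 1 2 * z ^ 3 + 2 * y * W 1 3 * z ^ 4 + 2 * W 1 4 * z ^ 5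
          + 2 * y * W 2 4 * z ^ 6 + 2 * y * W 3 4 * z ^ 7 + W 4 4 * z ^ 8) * hx
      - (W 2 2 * z ^ 4 + 2 * W 2 3 * z ^ 5 + W 3 3 * z ^ 6) * (y ^ 2 * hx + 5 * hy))
  have c2 := hcoeff 2
  have c3 := hcoeff 3
  have c4 := hcoeff 4
  have c5 := hcoeff 5
  have c6 := hcoeff 6
  have c7 := hcoeff 7
  have c8 := hcoeff 8
  have c9 := hcoeff 9
  have h55 : W 5 5 = 0 := hcoeff 10
  simp at c2 c3 c4 c5 c6 c7 c8 c9
  have h45 : W 4 5 = 0 := by simpa [hx0] using c9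
  have h35 : W 3 5 = 0 := by simpa [hx0, hy0, h44] using c8
  have h25 : W 2 5 = 0 := by simpa [hx0, hy0, h34] using c7
  have h15 : W 1 5 = 0 := by
    have : x * W 1 5 = 0 := by linear_combination c6 / 2 - 5 * h33
    simpa [hx0] using this
  have hrow (i j : Fin 6) : ∑ k, W i k * star (W j k) = (1 : Matrix (Fin 6) (Fin 6) ℂ) i j := by
    rw [← hU]; rfl
  have hnorm (i : Fin 6) : ∑ k, ‖W i k‖ ^ 2 = 1 := by
    have h := hrow i i
    simp only [Complex.star_def, Complex.mul_conj', Matrix.one_apply_eq] at h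
    exact_mod_cast h
  have n0 := hnorm 0
  have n1 := hnorm 1
  have n2 := hnorm 2
  have n4 := hnorm 4
  have n5 := hnorm 5
  simp only [Fin.sum_univ_six, hsymm 0 1, hsymm 0 2, hsymm 0 4, hsymm 0 5, hsymm 1 2,
    hsymm 1 4, hsymm 1 5, hsymm 2 4, hsymm 2 5, hsymm 3 4, hsymm 3 5, hsymm 4 5,
    h34, h44, h15, h25, h35, h45, h55, norm_zero] at n0 n1 n2 n4 n5
  have h02 : W 0 2 = 0 := by
    rw [← norm_eq_zero, ← sq_eq_zero_iff]
    nlinarith [sq_nonneg ‖W 0 0‖, sq_nonneg ‖W 0 1‖, sq_nonneg ‖W 0 2‖, sq_nonneg ‖W 0 3‖,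
      sq_nonneg ‖W 0 4‖]
  have h01 : W 0 1 = 0 := by
    rw [← norm_eq_zero, ← sq_eq_zero_iff]
    nlinarith [sq_nonneg ‖W 0 0‖, sq_nonneg ‖W 0 1‖, sq_nonneg ‖W 0 2‖, sq_nonneg ‖W 0 3‖,
      sq_nonneg ‖W 0 4‖]
  have h03 : W 0 3 = 0 := by
    rw [← norm_eq_zero, ← sq_eq_zero_iff]
    nlinarith [sq_nonneg ‖W 0 0‖, sq_nonneg ‖W 0 1‖, sq_nonneg ‖W 0 2‖, sq_nonneg ‖W 0 3‖,
      sq_nonneg ‖W 0 4‖]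
  have h04 : W 0 4 = 0 := by
    rw [← norm_eq_zero, ← sq_eq_zero_iff]
    nlinarith [sq_nonneg ‖W 0 0‖, sq_nonneg ‖W 0 1‖, sq_nonneg ‖W 0 2‖, sq_nonneg ‖W 0 3‖,
      sq_nonneg ‖W 0 4‖]
  have h11 : W 1 1 = 0 := by simpa [h02] using c2
  have h12 : W 1 2 = 0 := by simpa [h03, hy0] using c3
  have h22 : W 2 2 = -y * W 1 3 := by linear_combination c4 / 10 - x / 5 * h04
  have h33' : W 3 3 = -y * W 2 4 := by linear_combination h33
  have hprod := hrow 1 3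
  simp [Fin.sum_univ_six, hsymm 0 1, hsymm 0 3, hsymm 1 3, hsymm 2 3, h01, h11, h12, h15, h34, h33',
    hy0] at hprod
  simp only [h01, h02, h04, h11, h12, norm_zero] at n1 n2 n4
  have h13 : W 1 3 = 0 := by
    rcases hprod with h | h
    · exact h
    · rw [h, norm_zero] at n4
      rw [← norm_eq_zero, ← sq_eq_zero_iff]; linarith
  have h24 : W 2 4 = 0 := by
    rw [h13, norm_zero] at n1
    rw [← norm_eq_zero, ← sq_eq_zero_iff]; linarith
  simp only [h22, h24, h13, mul_zero, norm_zero] at n1 n2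
  have e05 : ‖W 0 5‖ = 1 := by
    rw [← sq_eq_sq₀ (norm_nonneg _) zero_le_one]; linarith
  have e14 : ‖W 1 4‖ = 1 := by
    rw [← sq_eq_sq₀ (norm_nonneg _) zero_le_one]; linarith
  have e23 : ‖W 2 3‖ = 1 := by
    rw [← sq_eq_sq₀ (norm_nonneg _) zero_le_one]; linarith
  have hdiff : 10 * W 2 3 = -(W 0 5 + 5 * W 1 4) := by linear_combination c5 / 2
  have hn := congrArg norm hdiff
  have htri := norm_add_le (W 0 5) (5 * W 1 4)
  rw [norm_neg, norm_mul] at hn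
  rw [norm_mul] at htri
  norm_num [e05, e14, e23] at hn htri
  linarith
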